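/- Members of the new rational Littlewood–Paley wavelet family at different scales are orthogonal: if j ≠ l are integers, then ⟨ψ^{m₁}_{j,n}, ψ^{m₂}_{l,k}⟩_{L²(ℝ)} = 0 for all integers n, k and all integers m₁, m₂ with 1 ≤ m₁, m₂ ≤ p − q. -/

import Mathlib

open MeasureTheory Real ComplexConjugate Filter Topology

noncomputable section

/-- The rational dilation factor `M = p / q`. -/
def Mdil (p q : ℕ) : ℝ := (p : ℝ) / (q : ℝ)

/-- The Fourier transform of the new rational Littlewood–Paley wavelet:
`√q` on `{ω : (q+m-1)π/q ≤ |ω| < (q+m)π/q}` and `0` elsewhere. -/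
def newHat (q m : ℕ) (ω : ℝ) : ℂ :=
  if ((q : ℝ) + (m : ℝ) - 1) * π / (q : ℝ) ≤ |ω| ∧ |ω| < ((q : ℝ) + (m : ℝ)) * π / (q : ℝ)
  then ((Real.sqrt q : ℝ) : ℂ) else 0

/-- The Fourier transform of Auscher's rational Littlewood–Paley wavelet:
`1` on `{ω : (q+m-1)π/q ≤ |ω| < (q+m)π/q}` and `0` elsewhere. -/
def auscherHat (q m : ℕ) (ω : ℝ) : ℂ :=
  if ((q : ℝ) + (m : ℝ) - 1) * π / (q : ℝ) ≤ |ω| ∧ |ω| < ((q : ℝ) + (m : ℝ)) * π / (q : ℝ)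
  then 1 else 0

/-- The inverse Fourier transform `t ↦ (1/(2π)) ∫ g(ω) e^{iωt} dω`
(for the convention `ĝ(ω) = ∫ g(x) e^{-iωx} dx`). -/
def invFT (g : ℝ → ℂ) (t : ℝ) : ℂ :=
  ((1 / (2 * π) : ℝ) : ℂ) * ∫ ω : ℝ, g ω * Complex.exp (Complex.I * (ω : ℂ) * (t : ℂ))

/-- The new rational Littlewood–Paley wavelet `ψ^m` in the time domain. -/
def newPsi (q m : ℕ) : ℝ → ℂ := invFT (newHat q m)

/-- Auscher's rational Littlewood–Paley wavelet `ψ^m` in the time domain. -/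
def auscherPsi (q m : ℕ) : ℝ → ℂ := invFT (auscherHat q m)

/-- The dilate–translate `x ↦ M^{-j/2} f (M^{-j} x - n q)`. -/
def dilTrans (p q : ℕ) (j n : ℤ) (f : ℝ → ℂ) : ℝ → ℂ := fun x =>
  ((Mdil p q ^ (-(j : ℝ) / 2) : ℝ) : ℂ) * f (Mdil p q ^ (-j) * x - (n : ℝ) * (q : ℝ))

/-- `ψ^m_{j,n}(x) = M^{-j/2} ψ^m (M^{-j} x - n q)` for the new wavelet. -/
def psiJN (p q m : ℕ) (j n : ℤ) : ℝ → ℂ := dilTrans p q j n (newPsi q m)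

/-- `ψ^m_{j,n}(x) = M^{-j/2} ψ^m (M^{-j} x - n q)` for Auscher's wavelet. -/
def auscherJN (p q m : ℕ) (j n : ℤ) : ℝ → ℂ := dilTrans p q j n (auscherPsi q m)

/-- The `L²` inner product `⟨f, g⟩ = ∫ f ḡ`. -/
def innerL2 (f g : ℝ → ℂ) : ℂ := ∫ x : ℝ, f x * conj (g x)

/-- The frequency band `{ω : M^{-j}(q+m-1)π/q ≤ |ω| < M^{-j}(q+m)π/q}`. -/
def bandJ (p q m : ℕ) (j : ℤ) : Set ℝ :=
  {ω : ℝ | Mdil p q ^ (-j) * (((q : ℝ) + (m : ℝ) - 1) * π / (q : ℝ)) ≤ |ω| ∧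
           |ω| < Mdil p q ^ (-j) * (((q : ℝ) + (m : ℝ)) * π / (q : ℝ))}

/-- The scale annulus `{ω : M^{-j}π ≤ |ω| < M^{-j+1}π}`. -/
def annulus (p q : ℕ) (j : ℤ) : Set ℝ :=
  {ω : ℝ | Mdil p q ^ (-j) * π ≤ |ω| ∧ |ω| < Mdil p q ^ (-j + 1) * π}

open FourierTransform Convolution in
/-- If `f` and `g` have pointwise vanishing product, then their Fourier transforms are
orthogonal. -/
theorem integral_fourier_mul_conj_fourier_eq_zero {f g : ℝ → ℂ} (hf : Integrable f)
    (hg : Integrable g) {C : ℝ} (hC : ∀ t, ‖g t‖ ≤ C) (hcont : ∀ᵐ t, ContinuousAt g t)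
    (hfg : ∀ t, f t * conj (g t) = 0) :
    ∫ x, 𝓕 f x * conj (𝓕 g x) = 0 := by
  by_cases hint : Integrable fun x => 𝓕 f x * conj (𝓕 g x)
  swap
  · exact integral_undef hint
  set g' : ℝ → ℂ := fun t => conj (g (-t)) with hg'
  have hconj : Integrable fun t => conj (g t) := by
    simpa using (Complex.conjCLE : ℂ →L[ℝ] ℂ).integrable_comp hg
  have hg'i : Integrable g' := hconj.comp_neg
  have hFg' : ∀ x, 𝓕 g' x = conj (𝓕 g x) := by
    intro x
    rw [Real.fourier_real_eq_integral_exp_smul, Real.fourier_real_eq_integral_exp_smul,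
      ← integral_conj, ← integral_neg_eq_self]
    refine integral_congr_ae (Eventually.of_forall fun t => ?_)
    simp [hg', ← Complex.exp_conj, Complex.conj_ofNat]
  set h : ℝ → ℂ := f ⋆[ContinuousLinearMap.mul ℂ ℂ] g' with hh
  have hhi : Integrable h := hf.integrable_convolution _ hg'i
  have hFh : 𝓕 h = fun x => 𝓕 f x * conj (𝓕 g x) := by
    funext x
    rw [hh, Real.fourier_mul_convolution_eq hf hg'i, hFg']
  have happ : ∀ x, h x = ∫ t, f t * conj (g (t - x)) := by
    intro x
    simp [hh, hg', convolution_def]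
  have h_zero : h 0 = 0 := by
    rw [happ]
    simp [hfg]
  have hc : ContinuousAt h 0 := by
    have hfun : h = fun x => ∫ t, f t * conj (g (t - x)) := funext happ
    rw [hfun]
    refine continuousAt_of_dominated (bound := fun t => ‖f t‖ * C) ?_ ?_ ?_ ?_
    · refine Eventually.of_forall fun x => ?_
      exact hf.1.mul (hconj.comp_sub_right x).1
    · refine Eventually.of_forall fun x => Eventually.of_forall fun t => ?_
      rw [norm_mul, RCLike.norm_conj]
      exact mul_le_mul_of_nonneg_left (hC _) (norm_nonneg _)
    · exact hf.norm.mul_const C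
    · filter_upwards [hcont] with t ht
      have h1 : ContinuousAt (fun x => g (t - x)) 0 := by
        refine ContinuousAt.comp (g := g) ?_ (by fun_prop)
        simpa using ht
      exact continuousAt_const.mul (Complex.continuous_conj.continuousAt.comp h1)
  have hinv := hhi.fourierInv_fourier_eq (by rw [hFh]; exact hint) hc
  rw [h_zero, hFh, Real.fourierInv_eq'] at hinv
  simpa using hinv

theorem newHat_eq_indicator (q m : ℕ) :
    newHat q m = Set.indicator {ω : ℝ | ((q : ℝ) + (m : ℝ) - 1) * π / (q : ℝ) ≤ |ω| ∧
      |ω| < ((q : ℝ) + (m : ℝ)) * π / (q : ℝ)} fun _ => ((Real.sqrt q : ℝ) : ℂ) := by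
  funext ω
  simp [newHat, Set.indicator_apply]

theorem integrable_newHat (q m : ℕ) : Integrable (newHat q m) := by
  rw [newHat_eq_indicator]
  have hmeas : MeasurableSet {ω : ℝ | ((q : ℝ) + (m : ℝ) - 1) * π / (q : ℝ) ≤ |ω| ∧
      |ω| < ((q : ℝ) + (m : ℝ)) * π / (q : ℝ)} :=
    (measurableSet_le measurable_const measurable_abs).inter
      (measurableSet_lt measurable_abs measurable_const)
  refine (integrable_indicator_iff hmeas).2 (integrableOn_const (ne_of_lt ?_))
  refine (measure_mono (t := Set.Icc (-(((q : ℝ) + m) * π / q)) (((q : ℝ) + m) * π / q))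
    fun ω hω => ?_).trans_lt measure_Icc_lt_top
  exact abs_le.1 hω.2.le

theorem norm_newHat_le (q m : ℕ) (ω : ℝ) : ‖newHat q m ω‖ ≤ Real.sqrt q := by
  unfold newHat
  split_ifs <;> simp [abs_of_nonneg, Real.sqrt_nonneg]

theorem newHat_neg (q m : ℕ) (ω : ℝ) : newHat q m (-ω) = newHat q m ω := by
  simp [newHat]

theorem continuousAt_newHat {q m : ℕ} {ω : ℝ}
    (h₁ : |ω| ≠ ((q : ℝ) + (m : ℝ) - 1) * π / (q : ℝ))
    (h₂ : |ω| ≠ ((q : ℝ) + (m : ℝ)) * π / (q : ℝ)) : ContinuousAt (newHat q m) ω := by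
  have habs : ContinuousAt (fun x : ℝ => |x|) ω := continuous_abs.continuousAt
  rcases lt_or_gt_of_ne h₁ with h | h
  · refine (continuousAt_const (y := (0 : ℂ))).congr ?_
    filter_upwards [habs.eventually_lt_const h] with x hx
    simp [newHat, not_le.2 hx]
  rcases lt_or_gt_of_ne h₂ with h' | h'
  · refine (continuousAt_const (y := ((Real.sqrt q : ℝ) : ℂ))).congr ?_
    filter_upwards [habs.eventually_lt_const h', habs.eventually_const_lt h] with x hx hx'
    simp [newHat, hx, hx'.le]
  · refine (continuousAt_const (y := (0 : ℂ))).congr ?_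
    filter_upwards [habs.eventually_const_lt h'] with x hx
    simp [newHat, not_lt.2 hx.le]

theorem ae_continuousAt_newHat_comp_mul (q m : ℕ) {s : ℝ} (hs : s ≠ 0) :
    ∀ᵐ v : ℝ, ContinuousAt (fun v => newHat q m (s * v)) v := by
  have hne : ∀ c : ℝ, ∀ᵐ v : ℝ, |s * v| ≠ c := by
    intro c
    have hfin : ({c / s, -c / s} : Set ℝ).Finite := Set.toFinite _
    filter_upwards [compl_mem_ae_iff.2 (hfin.measure_zero volume)] with v hv hvc
    apply hv
    rcases abs_choice (s * v) with h | h
    · left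
      field_simp
      linarith
    · right
      rw [Set.mem_singleton_iff]
      field_simp
      linarith
  filter_upwards [hne _, hne _] with v h₁ h₂
  exact (continuousAt_newHat h₁ h₂).comp (f := fun v => s * v) (by fun_prop)

/-- The Fourier transform of `psiJN p q m j n`, up to normalisation and reflection. -/
def psiFreq (p q m : ℕ) (j n : ℤ) (v : ℝ) : ℂ :=
  ((Mdil p q ^ (-(j : ℝ) / 2) / Mdil p q ^ (-j) : ℝ) : ℂ) *
    (newHat q m (2 * π / Mdil p q ^ (-j) * v) *
      Complex.exp ((2 * π / Mdil p q ^ (-j) * v * (n * q) : ℝ) * Complex.I))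

open FourierTransform in
theorem fourier_psiFreq {p q : ℕ} (hM : 0 < Mdil p q) (m : ℕ) (j n : ℤ) :
    psiJN p q m j n = 𝓕 (psiFreq p q m j n) := by
  funext x
  have ha : 0 < Mdil p q ^ (-j) := zpow_pos hM _
  rw [Real.fourier_real_eq_integral_exp_smul]
  unfold psiJN dilTrans newPsi invFT psiFreq
  set a := Mdil p q ^ (-j)
  set A := Mdil p q ^ (-(j : ℝ) / 2)
  have hs : 0 < 2 * π / a := by positivity
  have key := Measure.integral_comp_mul_left (fun ω : ℝ => newHat q m (-ω) *
    Complex.exp (Complex.I * ((-ω : ℝ) : ℂ) * ((a * x - n * q : ℝ) : ℂ))) (2 * π / a)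
  rw [integral_neg_eq_self (fun ω : ℝ => newHat q m ω *
    Complex.exp (Complex.I * (ω : ℂ) * ((a * x - n * q : ℝ) : ℂ))), abs_of_pos (by positivity)]
    at key
  have hsub : (∫ ω : ℝ, newHat q m ω *
      Complex.exp (Complex.I * (ω : ℂ) * ((a * x - n * q : ℝ) : ℂ))) =
      ((2 * π / a : ℝ) : ℂ) * ∫ v : ℝ, newHat q m (-(2 * π / a * v)) *
        Complex.exp (Complex.I * ((-(2 * π / a * v) : ℝ) : ℂ) * ((a * x - n * q : ℝ) : ℂ)) := by
    rw [key, Complex.real_smul, ← mul_assoc, ← Complex.ofReal_mul, mul_inv_cancel₀ hs.ne']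
    simp
  rw [hsub, ← mul_assoc, ← mul_assoc, ← integral_const_mul]
  refine integral_congr_ae (Eventually.of_forall fun v => ?_)
  have hconst : (A : ℂ) * ((1 / (2 * π) : ℝ) : ℂ) * ((2 * π / a : ℝ) : ℂ) =
      ((A / a : ℝ) : ℂ) := by
    rw [← Complex.ofReal_mul, ← Complex.ofReal_mul]
    congr 1
    field_simp
  have hexp : Complex.exp (Complex.I * ((-(2 * π / a * v) : ℝ) : ℂ) *
      ((a * x - n * q : ℝ) : ℂ)) = Complex.exp (((-2 * π * v * x : ℝ) : ℂ) * Complex.I) *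
      Complex.exp ((2 * π / a * v * (n * q) : ℝ) * Complex.I) := by
    rw [← Complex.exp_add]
    congr 1
    have haC : (a : ℂ) ≠ 0 := by exact_mod_cast ha.ne'
    push_cast
    field_simp
    ring
  simp only [hconst, hexp, newHat_neg, smul_eq_mul]
  ring_nf

theorem integrable_psiFreq {p q : ℕ} (hM : 0 < Mdil p q) (m : ℕ) (j n : ℤ) :
    Integrable (psiFreq p q m j n) := by
  have ha : 0 < Mdil p q ^ (-j) := zpow_pos hM _
  have hs : 2 * π / Mdil p q ^ (-j) ≠ 0 := by positivity
  refine Integrable.const_mul ?_ _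
  refine ((integrable_newHat q m).comp_mul_left' hs).mul_bdd (c := 1) ?_ ?_
  · exact Continuous.aestronglyMeasurable (by fun_prop)
  · exact Eventually.of_forall fun v => (Complex.norm_exp_ofReal_mul_I _).le

theorem norm_psiFreq_le (p q m : ℕ) (j n : ℤ) (v : ℝ) :
    ‖psiFreq p q m j n v‖ ≤
      ‖((Mdil p q ^ (-(j : ℝ) / 2) / Mdil p q ^ (-j) : ℝ) : ℂ)‖ * Real.sqrt q := by
  unfold psiFreq
  rw [norm_mul, norm_mul, Complex.norm_exp_ofReal_mul_I, mul_one]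
  exact mul_le_mul_of_nonneg_left (norm_newHat_le _ _ _) (norm_nonneg _)

theorem ae_continuousAt_psiFreq {p q : ℕ} (hM : 0 < Mdil p q) (m : ℕ) (j n : ℤ) :
    ∀ᵐ v, ContinuousAt (psiFreq p q m j n) v := by
  have ha : 0 < Mdil p q ^ (-j) := zpow_pos hM _
  have hs : 2 * π / Mdil p q ^ (-j) ≠ 0 := by positivity
  filter_upwards [ae_continuousAt_newHat_comp_mul q m hs] with v hv
  exact continuousAt_const.mul (hv.mul (Continuous.continuousAt (by fun_prop)))

theorem mem_annulus_of_psiFreq_ne_zero {p q m : ℕ} (hq : 1 ≤ q) (hpq : q < p) (hm : 1 ≤ m)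
    (hm' : m ≤ p - q) {j n : ℤ} {v : ℝ} (hv : psiFreq p q m j n v ≠ 0) :
    2 * π * v ∈ annulus p q j := by
  have hq0 : (0 : ℝ) < q := by exact_mod_cast hq
  have hp0 : (0 : ℝ) < p := by exact_mod_cast hq.trans_lt hpq |>.trans_le' zero_le_one
  have hM : 0 < Mdil p q := div_pos hp0 hq0
  have ha : 0 < Mdil p q ^ (-j) := zpow_pos hM _
  have hm1 : (1 : ℝ) ≤ m := by exact_mod_cast hm
  have hmp : (q : ℝ) + m ≤ p := by
    have : q + m ≤ p := by omega
    exact_mod_cast this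
  have hnew : newHat q m (2 * π / Mdil p q ^ (-j) * v) ≠ 0 :=
    left_ne_zero_of_mul (right_ne_zero_of_mul hv)
  obtain ⟨h₁, h₂⟩ := ite_ne_right_iff.1 hnew |>.1
  have habs : |2 * π * v| = Mdil p q ^ (-j) * |2 * π / Mdil p q ^ (-j) * v| := by
    rw [← abs_of_pos ha, ← abs_mul, abs_of_pos ha]
    congr 1
    field_simp
  constructor
  · rw [habs]
    refine mul_le_mul_of_nonneg_left (le_trans ?_ h₁) ha.le
    rw [le_div_iff₀ hq0]
    nlinarith [pi_pos]
  · rw [habs, zpow_add_one₀ hM.ne', mul_assoc]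
    refine mul_lt_mul_of_pos_left (h₂.trans_le ?_) ha
    rw [Mdil, div_mul_eq_mul_div]
    gcongr

theorem disjoint_annulus_of_lt {p q : ℕ} (hM : 1 < Mdil p q) {j l : ℤ} (h : j < l) :
    Disjoint (annulus p q j) (annulus p q l) := by
  rw [Set.disjoint_left]
  intro ω hj hl
  have hpow : Mdil p q ^ (-l + 1) ≤ Mdil p q ^ (-j) := zpow_le_zpow_right₀ hM.le (by omega)
  have := mul_le_mul_of_nonneg_right hpow pi_pos.le
  linarith [hj.1, hl.2]

/-- members of the new rational Littlewood–Paley wavelet family at different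
scales are orthogonal. -/
theorem newPsi_orthogonal_of_ne_scale (p q : ℕ) (hco : Nat.Coprime p q)
    (hq : 1 ≤ q) (hpq : q < p) (j l : ℤ) (hjl : j ≠ l) (n k : ℤ) (m₁ m₂ : ℕ)
    (hm₁ : 1 ≤ m₁) (hm₁' : m₁ ≤ p - q) (hm₂ : 1 ≤ m₂) (hm₂' : m₂ ≤ p - q) :
    innerL2 (psiJN p q m₁ j n) (psiJN p q m₂ l k) = 0 := by
  have hq0 : (0 : ℝ) < q := by exact_mod_cast hq
  have hM1 : 1 < Mdil p q := by
    rw [Mdil, one_lt_div hq0]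
    exact_mod_cast hpq
  have hM : 0 < Mdil p q := one_pos.trans hM1
  have hdisj : Disjoint (annulus p q j) (annulus p q l) := by
    rcases lt_or_gt_of_ne hjl with h | h
    · exact disjoint_annulus_of_lt hM1 h
    · exact (disjoint_annulus_of_lt hM1 h).symm
  rw [innerL2, fourier_psiFreq hM, fourier_psiFreq hM]
  refine integral_fourier_mul_conj_fourier_eq_zero (integrable_psiFreq hM m₁ j n)
    (integrable_psiFreq hM m₂ l k) (norm_psiFreq_le p q m₂ l k)
    (ae_continuousAt_psiFreq hM m₂ l k) fun v => ?_
  by_contra hne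
  refine Set.disjoint_left.1 hdisj
    (mem_annulus_of_psiFreq_ne_zero hq hpq hm₁ hm₁' (left_ne_zero_of_mul hne))
    (mem_annulus_of_psiFreq_ne_zero hq hpq hm₂ hm₂' (n := k) fun h => ?_)
  simp [h] at hne
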